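/- Let T > 0 and let F : ℝ → ℝ be continuous and strictly increasing. Let φ : [0,T] → ℝ be continuous on [0,T] and twice differentiable on (0,T) with φ″(t) ≥ F(φ(t)) for every t ∈ (0,T), and let ψ : (0,T) → ℝ be twice differentiable with ψ″(t) ≤ F(ψ(t)) for every t ∈ (0,T) and ψ(t) → +∞ both as t → 0⁺ and as t → T⁻. Then φ(t) ≤ ψ(t) for every t ∈ (0,T). -/

import Mathlib

open Filter

/-- The second-order necessary condition at a local maximum. -/
theorem IsLocalMax.deriv_deriv_nonpos {f : ℝ → ℝ} {x : ℝ} (h : IsLocalMax f x)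
    (hc : ContinuousAt f x) : deriv (deriv f) x ≤ 0 := by
  by_contra! hpos
  have hmin : IsLocalMin f x := isLocalMin_of_deriv_deriv_pos hpos h.deriv_eq_zero hc
  have hconst : f =ᶠ[nhds x] fun _ => f x := by
    filter_upwards [h, hmin] with y hy hy' using le_antisymm hy hy'
  have hzero : deriv (deriv f) x = 0 := by simpa using hconst.deriv.deriv_eq
  exact hpos.ne' hzero

/-- Comparison principle for second-order differential inequalities with a
strictly increasing nonlinearity and a supersolution blowing up at both
endpoints. -/
theorem comparison_principle_blowup_barrier
    (T : ℝ) (hT : 0 < T) (F : ℝ → ℝ) (hFcont : Continuous F)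
    (hFmono : StrictMono F)
    (φ : ℝ → ℝ)
    (hφcont : ContinuousOn φ (Set.Icc 0 T))
    (hφdiff : ∀ t ∈ Set.Ioo (0 : ℝ) T, DifferentiableAt ℝ φ t)
    (hφdiff2 : ∀ t ∈ Set.Ioo (0 : ℝ) T, DifferentiableAt ℝ (deriv φ) t)
    (hφineq : ∀ t ∈ Set.Ioo (0 : ℝ) T, deriv (deriv φ) t ≥ F (φ t))
    (ψ : ℝ → ℝ)
    (hψdiff : ∀ t ∈ Set.Ioo (0 : ℝ) T, DifferentiableAt ℝ ψ t)
    (hψdiff2 : ∀ t ∈ Set.Ioo (0 : ℝ) T, DifferentiableAt ℝ (deriv ψ) t)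
    (hψineq : ∀ t ∈ Set.Ioo (0 : ℝ) T, deriv (deriv ψ) t ≤ F (ψ t))
    (hblow0 : Tendsto ψ (nhdsWithin 0 (Set.Ioi (0 : ℝ))) atTop)
    (hblowT : Tendsto ψ (nhdsWithin T (Set.Iio T)) atTop) :
    ∀ t ∈ Set.Ioo (0 : ℝ) T, φ t ≤ ψ t := by
  intro t ht
  by_contra! hlt
  obtain ⟨M, hM⟩ := isCompact_Icc.bddAbove_image hφcont
  have hφM : ∀ x ∈ Set.Icc (0 : ℝ) T, φ x ≤ M := fun x hx => hM ⟨x, hx, rfl⟩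
  obtain ⟨a, haM, ha⟩ :=
    ((hblow0.eventually_gt_atTop M).and (Ioo_mem_nhdsGT ht.1)).exists
  obtain ⟨b, hbM, hb⟩ :=
    ((hblowT.eventually_gt_atTop M).and (Ioo_mem_nhdsLT ht.2)).exists
  have hφa := hφM a ⟨ha.1.le, (ha.2.trans ht.2).le⟩
  have hφb := hφM b ⟨(ht.1.trans hb.1).le, hb.2.le⟩
  have hsub : Set.Icc a b ⊆ Set.Ioo 0 T :=
    fun x hx => ⟨ha.1.trans_le hx.1, hx.2.trans_lt hb.2⟩
  have hcont : ContinuousOn (φ - ψ) (Set.Icc a b) := fun x hx =>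
    ((hφdiff x (hsub hx)).sub (hψdiff x (hsub hx))).continuousAt.continuousWithinAt
  have htab : t ∈ Set.Icc a b := ⟨ha.2.le, hb.1.le⟩
  obtain ⟨c, hc, hmax⟩ := isCompact_Icc.exists_isMaxOn ⟨t, htab⟩ hcont
  have htc : φ t - ψ t ≤ φ c - ψ c := hmax htab
  have hca : a ≠ c := by rintro rfl; linarith
  have hcb : c ≠ b := by rintro rfl; linarith
  have hlocal : IsLocalMax (φ - ψ) c :=
    hmax.isLocalMax (Icc_mem_nhds (hc.1.lt_of_ne hca) (hc.2.lt_of_ne hcb))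
  have hcT := hsub hc
  have hderiv : deriv (φ - ψ) =ᶠ[nhds c] deriv φ - deriv ψ := by
    filter_upwards [isOpen_Ioo.mem_nhds hcT] with x hx
    exact deriv_sub (hφdiff x hx) (hψdiff x hx)
  have hnonpos := hlocal.deriv_deriv_nonpos
    ((hφdiff c hcT).sub (hψdiff c hcT)).continuousAt
  rw [hderiv.deriv_eq, deriv_sub (hφdiff2 c hcT) (hψdiff2 c hcT)] at hnonpos
  have hF : F (ψ c) < F (φ c) := hFmono (by linarith)
  linarith [hφineq c hcT, hψineq c hcT]
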